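/- Every holomorphic isometry of the complex hyperbolic plane is a commutator of holomorphic isometries (the commutator length of PU(2,1) is 1): for every 3×3 complex matrix A with Aᴴ J A = J there exist matrices B, C with Bᴴ J B = J and Cᴴ J C = J, and a nonzero scalar λ ∈ ℂ, such that A = λ · (B C B⁻¹ C⁻¹). -/

import Mathlib

open Matrix

/-- The Hermitian form of signature (2,1) on ℂ³ (ball model). -/
noncomputable def Jball : Matrix (Fin 3) (Fin 3) ℂ := Matrix.diagonal ![1, 1, -1]

/-- Membership in U(2,1). -/
def InU21 (A : Matrix (Fin 3) (Fin 3) ℂ) : Prop := Aᴴ * Jball * A = Jball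

lemma norm_eq_one_of_star_mul_self {z : ℂ} (h : star z * z = 1) : ‖z‖ = 1 := by
  have h := congrArg norm h
  rw [norm_mul, norm_star, norm_one] at h
  nlinarith [norm_nonneg z]

/-- The sesquilinear form attached to `Jball`, conjugate-linear in the first variable. -/
noncomputable def herm (x y : Fin 3 → ℂ) : ℂ := star x ⬝ᵥ (Jball *ᵥ y)

lemma herm_apply (x y : Fin 3 → ℂ) :
    herm x y = star (x 0) * y 0 + star (x 1) * y 1 - star (x 2) * y 2 := by
  simp [herm, Jball, mulVec_diagonal, dotProduct, Fin.sum_univ_three]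
  ring

lemma star_herm (x y : Fin 3 → ℂ) : star (herm x y) = herm y x := by
  simp [herm_apply]
  ring

lemma herm_smul_left (c : ℂ) (x y : Fin 3 → ℂ) : herm (c • x) y = star c * herm x y := by
  simp [herm_apply]
  ring

lemma herm_smul_right (c : ℂ) (x y : Fin 3 → ℂ) : herm x (c • y) = c * herm x y := by
  simp [herm_apply]
  ring

lemma herm_self_eq_re (x : Fin 3 → ℂ) : herm x x = ((herm x x).re : ℂ) :=
  (Complex.conj_eq_iff_re.mp (star_herm x x)).symm

lemma herm_self_re (x : Fin 3 → ℂ) :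
    (herm x x).re = Complex.normSq (x 0) + Complex.normSq (x 1) - Complex.normSq (x 2) := by
  simp [herm_apply, Complex.normSq_apply]

lemma herm_mulVec_mulVec (P Q : Matrix (Fin 3) (Fin 3) ℂ) (x y : Fin 3 → ℂ) :
    herm (P *ᵥ x) (Q *ᵥ y) = star x ⬝ᵥ ((Pᴴ * Jball * Q) *ᵥ y) := by
  simp only [herm, star_mulVec, ← mulVec_mulVec, ← dotProduct_mulVec]

lemma Jball_mul_self : Jball * Jball = 1 := by
  ext i j
  fin_cases i <;> fin_cases j <;> simp [Jball]

lemma det_Jball : Jball.det = -1 := by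
  simp [Jball, det_diagonal, Fin.prod_univ_three]

lemma exists_smul_herm_eq_one {u : Fin 3 → ℂ} (hu : 0 < (herm u u).re) :
    ∃ s : ℂ, herm (s • u) (s • u) = 1 := by
  refine ⟨((√(herm u u).re)⁻¹ : ℝ), ?_⟩
  rw [herm_smul_left, herm_smul_right, herm_self_eq_re u, Complex.star_def, Complex.conj_ofReal]
  norm_cast
  rw [← mul_assoc, ← mul_inv, Real.mul_self_sqrt hu.le, inv_mul_cancel₀ hu.ne']

namespace InU21

variable {A B : Matrix (Fin 3) (Fin 3) ℂ}

lemma herm_mulVec (hA : InU21 A) (x y : Fin 3 → ℂ) : herm (A *ᵥ x) (A *ᵥ y) = herm x y := by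
  rw [herm_mulVec_mulVec, hA, herm]

lemma one : InU21 1 := by simp [InU21]

lemma mul (hA : InU21 A) (hB : InU21 B) : InU21 (A * B) := by
  unfold InU21 at *
  calc (A * B)ᴴ * Jball * (A * B) = Bᴴ * (Aᴴ * Jball * A) * B := by
        simp only [conjTranspose_mul, Matrix.mul_assoc]
    _ = Jball := by rw [hA, hB]

lemma smul (hA : InU21 A) {c : ℂ} (hc : star c * c = 1) : InU21 (c • A) := by
  unfold InU21 at *
  rw [conjTranspose_smul, Matrix.smul_mul, Matrix.smul_mul, Matrix.mul_smul, smul_smul, hA, hc,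
    one_smul]

lemma left_inv (hA : InU21 A) : Jball * Aᴴ * Jball * A = 1 := by
  rw [Matrix.mul_assoc Jball, Matrix.mul_assoc Jball, hA, Jball_mul_self]

lemma isUnit_det (hA : InU21 A) : IsUnit A.det :=
  isUnit_det_of_left_inverse hA.left_inv

lemma inv_eq (hA : InU21 A) : A⁻¹ = Jball * Aᴴ * Jball :=
  inv_eq_left_inv hA.left_inv

lemma star_det_mul_det (hA : InU21 A) : star A.det * A.det = 1 := by
  have h := congrArg det hA
  simp only [det_mul, det_conjTranspose, det_Jball] at h
  linear_combination -h

lemma inv (hA : InU21 A) : InU21 A⁻¹ := by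
  have h := hA.isUnit_det
  unfold InU21
  rw [conjTranspose_nonsing_inv]
  have h' : IsUnit Aᴴ.det := by simpa [det_conjTranspose] using h
  calc (Aᴴ)⁻¹ * Jball * A⁻¹ = (Aᴴ)⁻¹ * (Aᴴ * Jball * A) * A⁻¹ := by rw [hA]
    _ = ((Aᴴ)⁻¹ * Aᴴ) * Jball * (A * A⁻¹) := by simp only [Matrix.mul_assoc]
    _ = Jball := by rw [nonsing_inv_mul _ h', mul_nonsing_inv _ h]; simp

/-- The characteristic polynomial of an element of `U(2,1)` only depends on its trace and
determinant. -/
lemma det_sub_smul_one (hA : InU21 A) (x : ℂ) :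
    (A - x • (1 : Matrix (Fin 3) (Fin 3) ℂ)).det =
      A.det - A.det * star A.trace * x + A.trace * x ^ 2 - x ^ 3 := by
  have hadj : A.adjugate = A.det • (Jball * Aᴴ * Jball) := by
    calc A.adjugate = (Jball * Aᴴ * Jball * A) * A.adjugate := by rw [hA.left_inv, one_mul]
      _ = A.det • (Jball * Aᴴ * Jball) := by
        rw [Matrix.mul_assoc _ A, mul_adjugate, Matrix.mul_smul, Matrix.mul_one]
  have htr : A.adjugate.trace = A.det * star A.trace := by
    rw [hadj, trace_smul, trace_mul_cycle, Jball_mul_self, one_mul, trace_conjTranspose,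
      smul_eq_mul]
  rw [← htr, adjugate_fin_three]
  simp [det_fin_three, trace_fin_three]
  ring

end InU21

/-- Gram matrix of a basis made of a positive unit vector and two null vectors. -/
def nullGram : Matrix (Fin 3) (Fin 3) ℂ := !![1, 0, 0; 0, 0, 1; 0, 1, 0]

lemma gram_cols (p : Fin 3 → Fin 3 → ℂ) :
    ((of p)ᵀ)ᴴ * Jball * (of p)ᵀ = of fun i j => herm (p i) (p j) := by
  ext i j
  have hp : ∀ k, p k = (of p)ᵀ *ᵥ Pi.single k 1 := fun k => by
    rw [mulVec_single_one]
    rfl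
  rw [of_apply, hp i, hp j, herm_mulVec_mulVec]
  simp

lemma mul_cols_eq {X : Matrix (Fin 3) (Fin 3) ℂ} {p : Fin 3 → Fin 3 → ℂ} {d : Fin 3 → ℂ}
    (h : ∀ i, X *ᵥ p i = d i • p i) : X * (of p)ᵀ = (of p)ᵀ * diagonal d := by
  ext i j
  have := congrFun (h j) i
  rw [mul_diagonal]
  simp only [mulVec, dotProduct, Pi.smul_apply, smul_eq_mul] at this
  simp [mul_apply, this, mul_comm]

lemma exists_eigenvector_of_det {X : Matrix (Fin 3) (Fin 3) ℂ} {x : ℂ}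
    (h : (X - x • (1 : Matrix (Fin 3) (Fin 3) ℂ)).det = 0) :
    ∃ v : Fin 3 → ℂ, v ≠ 0 ∧ X *ᵥ v = x • v := by
  obtain ⟨v, hv, h⟩ := exists_mulVec_eq_zero_iff.mpr h
  refine ⟨v, hv, ?_⟩
  rw [sub_mulVec, smul_mulVec, one_mulVec, sub_eq_zero] at h
  exact h

lemma InU21.herm_eigenvectors {X : Matrix (Fin 3) (Fin 3) ℂ} (hX : InU21 X) {x y : ℂ}
    {v w : Fin 3 → ℂ} (hv : X *ᵥ v = x • v) (hw : X *ᵥ w = y • w) (h : star x * y ≠ 1) :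
    herm v w = 0 := by
  have := hX.herm_mulVec v w
  rw [hv, hw, herm_smul_left, herm_smul_right] at this
  have h2 : (star x * y - 1) * herm v w = 0 := by linear_combination this
  exact (mul_eq_zero.mp h2).resolve_left (sub_ne_zero.mpr h)

/-- A loxodromic element of `U(2,1)` is diagonal in a basis with standard Gram matrix. -/
lemma InU21.exists_loxodromic_frame {X : Matrix (Fin 3) (Fin 3) ℂ} (hX : InU21 X) {m : ℂ} {r : ℝ}
    (hm : star m * m = 1) (hr0 : 0 < r) (hr1 : r ≠ 1)
    (h0 : (X - m • (1 : Matrix (Fin 3) (Fin 3) ℂ)).det = 0)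
    (h1 : (X - (r : ℂ) • (1 : Matrix (Fin 3) (Fin 3) ℂ)).det = 0)
    (h2 : (X - ((r⁻¹ : ℝ) : ℂ) • (1 : Matrix (Fin 3) (Fin 3) ℂ)).det = 0) :
    ∃ P : Matrix (Fin 3) (Fin 3) ℂ, Pᴴ * Jball * P = nullGram ∧
      X * P = P * diagonal ![m, (r : ℂ), ((r⁻¹ : ℝ) : ℂ)] := by
  obtain ⟨u, hu, hXu⟩ := exists_eigenvector_of_det h0
  obtain ⟨v, hv, hXv⟩ := exists_eigenvector_of_det h1
  obtain ⟨w, hw, hXw⟩ := exists_eigenvector_of_det h2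
  have hrr : r * r ≠ 1 := fun h => hr1 (by nlinarith)
  have hmn := norm_eq_one_of_star_mul_self hm
  have hne1 : m ≠ (r : ℂ) := by
    rintro rfl
    rw [Complex.norm_real, Real.norm_of_nonneg hr0.le] at hmn
    exact hr1 hmn
  have hne2 : m ≠ ((r⁻¹ : ℝ) : ℂ) := by
    rintro rfl
    rw [Complex.norm_real, Real.norm_of_nonneg (by positivity)] at hmn
    exact hr1 (inv_eq_one.mp hmn)
  have hne3 : (r : ℂ) ≠ ((r⁻¹ : ℝ) : ℂ) := by
    intro h
    have h := Complex.ofReal_injective h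
    field_simp at h
    exact hrr (by nlinarith)
  have hvv : herm v v = 0 := hX.herm_eigenvectors hXv hXv (by
    simpa using fun h => hrr (by exact_mod_cast h))
  have hww : herm w w = 0 := hX.herm_eigenvectors hXw hXw (by
    simp only [Complex.star_def, Complex.conj_ofReal]
    intro h
    have h : r⁻¹ * r⁻¹ = 1 := by exact_mod_cast h
    field_simp at h
    exact hrr (by nlinarith))
  have horth : ∀ {z : Fin 3 → ℂ} {x : ℝ}, m ≠ (x : ℂ) → X *ᵥ z = (x : ℂ) • z →
      herm u z = 0 := by
    intro z x hne hz
    refine hX.herm_eigenvectors hXu hz fun h => hne ?_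
    have : (x : ℂ) = m := by linear_combination m * h - (x : ℂ) * hm
    exact this.symm
  have huv := horth hne1 hXv
  have huw := horth hne2 hXw
  have hvu : herm v u = 0 := by rw [← star_herm, huv, star_zero]
  have hwu : herm w u = 0 := by rw [← star_herm, huw, star_zero]
  let p : Fin 3 → Fin 3 → ℂ := ![u, v, w]
  let d : Fin 3 → ℂ := ![m, (r : ℂ), ((r⁻¹ : ℝ) : ℂ)]
  have hinj : Function.Injective d := by
    intro i j h
    fin_cases i <;> fin_cases j <;> simp_all [d]
  have hli : LinearIndependent ℂ p := by
    refine Module.End.eigenvectors_linearIndependent' (toLin' X) d hinj p fun i => ?_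
    rw [Module.End.hasEigenvector_iff, Module.End.mem_eigenspace_iff]
    fin_cases i <;> simp [p, d, *]
  have hdet : ((of p)ᵀ).det ≠ 0 := by
    rw [det_transpose]
    have := (linearIndependent_rows_iff_isUnit (A := of p)).mp hli
    exact ((isUnit_iff_isUnit_det _).mp this).ne_zero
  have hgram : (((of p)ᵀ)ᴴ * Jball * (of p)ᵀ) =
      !![herm u u, 0, 0; 0, 0, herm v w; 0, herm w v, 0] := by
    rw [gram_cols]
    ext i j
    fin_cases i <;> fin_cases j <;> simp [p, *]
  have hpos : 0 < (herm u u).re ∧ herm v w ≠ 0 := by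
    have h := congrArg det hgram
    have hR : (!![herm u u, 0, 0; 0, 0, herm v w; 0, herm w v, 0]).det =
        -(herm u u * (herm v w * herm w v)) := by
      simp [det_fin_three]
      ring
    rw [det_mul, det_mul, det_conjTranspose, det_Jball, hR, Complex.star_def] at h
    have h' : herm u u * (herm v w * herm w v) = ((Complex.normSq (of p)ᵀ.det : ℝ) : ℂ) := by
      rw [Complex.normSq_eq_conj_mul_self]
      linear_combination h
    rw [← star_herm v w, Complex.star_def, Complex.mul_conj, herm_self_eq_re u] at h'
    have h' : (herm u u).re * Complex.normSq (herm v w) = Complex.normSq (of p)ᵀ.det := by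
      exact_mod_cast h'
    have hd := Complex.normSq_pos.mpr hdet
    rw [← h'] at hd
    have hk : herm v w ≠ 0 := by
      intro hk
      simp [hk] at hd
    exact ⟨pos_of_mul_pos_left hd (Complex.normSq_nonneg _), hk⟩
  obtain ⟨hpos, hk⟩ := hpos
  obtain ⟨s, hs⟩ := exists_smul_herm_eq_one hpos
  let q : Fin 3 → Fin 3 → ℂ := ![s • u, v, (herm v w)⁻¹ • w]
  have hwv : herm w v ≠ 0 := by
    rw [← star_herm]
    exact star_ne_zero.mpr hk
  refine ⟨(of q)ᵀ, ?_, ?_⟩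
  · rw [gram_cols]
    ext i j
    rw [herm_smul_left, herm_smul_right, Complex.star_def] at hs
    have hkk := star_herm v w
    rw [Complex.star_def] at hkk
    fin_cases i <;> fin_cases j <;>
      simp [q, nullGram, herm_smul_left, herm_smul_right, hvv, hww, huv, huw, hvu, hwu, hk, hkk,
        hwv]
    linear_combination hs
  · refine mul_cols_eq fun i => ?_
    fin_cases i <;> simp [q, mulVec_smul, hXu, hXv, hXw, smul_smul, mul_comm]

/-- `A` is a commutator of elements of `U(2,1)`. -/
def IsCommU21 (A : Matrix (Fin 3) (Fin 3) ℂ) : Prop :=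
  ∃ B C : Matrix (Fin 3) (Fin 3) ℂ, InU21 B ∧ InU21 C ∧ A = B * C * B⁻¹ * C⁻¹

lemma IsCommU21.conj {A P : Matrix (Fin 3) (Fin 3) ℂ} (hP : InU21 P)
    (h : IsCommU21 (P⁻¹ * A * P)) : IsCommU21 A := by
  obtain ⟨B, C, hB, hC, h⟩ := h
  have hu := hP.isUnit_det
  refine ⟨P * B * P⁻¹, P * C * P⁻¹, (hP.mul hB).mul hP.inv, (hP.mul hC).mul hP.inv, ?_⟩
  have hA : A = P * (P⁻¹ * A * P) * P⁻¹ := by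
    simp only [Matrix.mul_assoc, mul_nonsing_inv_cancel_left _ _ hu, mul_nonsing_inv _ hu,
      Matrix.mul_one]
  rw [hA, h]
  simp only [Matrix.mul_inv_rev, nonsing_inv_nonsing_inv _ hu, Matrix.mul_assoc,
    nonsing_inv_mul_cancel_left _ _ hu]

lemma isUnit_det_of_gram {P H : Matrix (Fin 3) (Fin 3) ℂ} (hP : Pᴴ * Jball * P = H)
    (hH : H.det ≠ 0) : IsUnit P.det := by
  rw [← hP, det_mul] at hH
  exact isUnit_iff_ne_zero.mpr (right_ne_zero_of_mul hH)

lemma InU21.isCommU21_of_trace {A Q : Matrix (Fin 3) (Fin 3) ℂ} (hA : InU21 A) (hQ : InU21 Q)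
    (hdet : A.det = 1) (htr : (A * Q).trace = Q.trace) {m : ℂ} {r : ℝ}
    (hm : star m * m = 1) (hr0 : 0 < r) (hr1 : r ≠ 1)
    (h0 : (Q - m • (1 : Matrix (Fin 3) (Fin 3) ℂ)).det = 0)
    (h1 : (Q - (r : ℂ) • (1 : Matrix (Fin 3) (Fin 3) ℂ)).det = 0)
    (h2 : (Q - ((r⁻¹ : ℝ) : ℂ) • (1 : Matrix (Fin 3) (Fin 3) ℂ)).det = 0) : IsCommU21 A := by
  have hchar : ∀ x : ℂ, (A * Q - x • (1 : Matrix (Fin 3) (Fin 3) ℂ)).det =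
      (Q - x • (1 : Matrix (Fin 3) (Fin 3) ℂ)).det := by
    intro x
    rw [(hA.mul hQ).det_sub_smul_one, hQ.det_sub_smul_one, htr, det_mul, hdet, one_mul]
  obtain ⟨P, hP, hQP⟩ := hQ.exists_loxodromic_frame hm hr0 hr1 h0 h1 h2
  obtain ⟨R, hR, hAR⟩ := (hA.mul hQ).exists_loxodromic_frame hm hr0 hr1
    ((hchar _).trans h0) ((hchar _).trans h1) ((hchar _).trans h2)
  have hPu := isUnit_det_of_gram hP (by simp [nullGram, det_fin_three])
  have hPu' : IsUnit Pᴴ.det := by simpa [det_conjTranspose] using hPu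
  have hC : InU21 (R * P⁻¹) := by
    unfold InU21
    calc (R * P⁻¹)ᴴ * Jball * (R * P⁻¹) = (Pᴴ)⁻¹ * (Rᴴ * Jball * R) * P⁻¹ := by
          simp only [conjTranspose_mul, conjTranspose_nonsing_inv, Matrix.mul_assoc]
      _ = (Pᴴ)⁻¹ * (Pᴴ * Jball * P) * P⁻¹ := by rw [hR, hP]
      _ = Jball := by
        simp only [Matrix.mul_assoc, nonsing_inv_mul_cancel_left _ _ hPu', mul_nonsing_inv _ hPu,
          Matrix.mul_one]
  refine ⟨R * P⁻¹, Q, hC, hQ, ?_⟩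
  have hcomm : A * Q * (R * P⁻¹) = R * P⁻¹ * Q := by
    rw [← Matrix.mul_assoc, hAR]
    have : Q = P * diagonal ![m, (r : ℂ), ((r⁻¹ : ℝ) : ℂ)] * P⁻¹ := by
      rw [← hQP, mul_nonsing_inv_cancel_right _ _ hPu]
    rw [this]
    simp only [Matrix.mul_assoc, nonsing_inv_mul_cancel_left _ _ hPu]
  rw [← hcomm, mul_nonsing_inv_cancel_right _ _ hC.isUnit_det,
    mul_nonsing_inv_cancel_right _ _ hQ.isUnit_det]

lemma exists_norm_cosh_add_sinh_eq {T N : ℂ} {ρ : ℝ} (hT : T ≠ 0) (hρ : ‖T‖ < ρ) :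
    ∃ x : ℝ, x ≠ 0 ∧ ‖(Real.cosh x : ℂ) * T + (Real.sinh x : ℂ) * N‖ = ρ := by
  have hT' : 0 < ‖T‖ := norm_pos_iff.mpr hT
  have hcont : Continuous fun x : ℝ => ‖(Real.cosh x : ℂ) * T + (Real.sinh x : ℂ) * N‖ := by
    have := Real.continuous_cosh
    have := Real.continuous_sinh
    fun_prop
  have hρ0 : 0 < ρ := hT'.trans hρ
  set y := ρ / ‖T‖
  have hy : ρ ≤ Real.cosh y * ‖T‖ := by
    have h1 : y ≤ Real.cosh y :=
      (Real.self_le_sinh_iff.mpr (by positivity)).trans (Real.sinh_lt_cosh y).le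
    calc ρ = y * ‖T‖ := by simp [y, hT'.ne']
      _ ≤ _ := by gcongr
  have hbig : ∃ x : ℝ, ρ ≤ ‖(Real.cosh x : ℂ) * T + (Real.sinh x : ℂ) * N‖ := by
    by_contra! hcon
    have h1 := hcon y
    have h2 := hcon (-y)
    rw [Real.cosh_neg, Real.sinh_neg] at h2
    have h3 := norm_add_le ((Real.cosh y : ℂ) * T + (Real.sinh y : ℂ) * N)
      ((Real.cosh y : ℂ) * T + ((-Real.sinh y : ℝ) : ℂ) * N)
    have h4 : (Real.cosh y : ℂ) * T + (Real.sinh y : ℂ) * N +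
      ((Real.cosh y : ℂ) * T + ((-Real.sinh y : ℝ) : ℂ) * N) =
        ((2 * Real.cosh y : ℝ) : ℂ) * T := by
      push_cast
      ring
    rw [h4, norm_mul, Complex.norm_real, Real.norm_of_nonneg
      (by have := Real.cosh_pos y; positivity)] at h3
    linarith
  obtain ⟨x, hx⟩ := mem_range_of_exists_le_of_exists_ge hcont
    ⟨0, by simpa using hρ.le⟩ hbig
  refine ⟨x, ?_, hx⟩
  rintro rfl
  simp only [Real.cosh_zero, Real.sinh_zero, Complex.ofReal_one, Complex.ofReal_zero, one_mul,
    zero_mul, add_zero] at hx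
  exact hρ.ne hx

lemma InU21.isCommU21_of_entry {A : Matrix (Fin 3) (Fin 3) ℂ} (hA : InU21 A) (hdet : A.det = 1)
    (h0 : A.trace - A 0 0 - 2 ≠ 0) (h1 : ‖A.trace - A 0 0 - 2‖ < ‖A 0 0 - 1‖) :
    IsCommU21 A := by
  obtain ⟨x, hx, h⟩ := exists_norm_cosh_add_sinh_eq (N := A 1 2 + A 2 1) h0 h1
  have hne : A 0 0 - 1 ≠ 0 := by
    rw [← norm_pos_iff]
    exact (norm_nonneg _).trans_lt h1
  have hcs : (Real.cosh x : ℂ) ^ 2 - (Real.sinh x : ℂ) ^ 2 = 1 := by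
    exact_mod_cast Real.cosh_sq_sub_sinh_sq x
  have he : ((Real.exp x : ℝ) : ℂ) = Real.cosh x + Real.sinh x := by
    rw [← Real.cosh_add_sinh]
    push_cast
    rfl
  have he' : (((Real.exp x)⁻¹ : ℝ) : ℂ) = Real.cosh x - Real.sinh x := by
    rw [← Real.exp_neg, ← Real.cosh_sub_sinh]
    push_cast
    rfl
  set c : ℂ := (Real.cosh x : ℂ) with hc
  set s : ℂ := (Real.sinh x : ℂ) with hs
  set z := c * (A.trace - A 0 0 - 2) + s * (A 1 2 + A 2 1) with hz
  set m := -z / (A 0 0 - 1) with hmdef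
  have hmn : ‖m‖ = 1 := by
    rw [hmdef, norm_div, norm_neg, h, div_self (norm_ne_zero_iff.mpr hne)]
  have hm : star m * m = 1 := by
    rw [Complex.star_def, Complex.conj_mul', hmn]
    simp
  have hmz : m * (A 0 0 - 1) = -z := div_mul_cancel₀ _ hne
  have hcc : (starRingEnd ℂ) c = c := Complex.conj_ofReal _
  have hsc : (starRingEnd ℂ) s = s := Complex.conj_ofReal _
  let Q : Matrix (Fin 3) (Fin 3) ℂ := !![m, 0, 0; 0, c, s; 0, s, c]
  have hQ : InU21 Q := by
    rw [Complex.star_def] at hm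
    unfold InU21
    ext i j
    fin_cases i <;> fin_cases j <;>
      simp [Q, Jball, mul_apply, Fin.sum_univ_three, hcc, hsc, diagonal_apply]
    · exact hm
    · linear_combination hcs
    · ring
    · ring
    · linear_combination -hcs
  refine hA.isCommU21_of_trace hQ hdet ?_ hm (Real.exp_pos x) (by simpa using hx) ?_ ?_ ?_
  · rw [trace_fin_three] at hz
    simp [Q, trace_fin_three, mul_apply, Fin.sum_univ_three]
    linear_combination hmz - hz
  · simp [Q, det_fin_three]
  · rw [he]
    simp [Q, det_fin_three]
  · rw [he']
    simp [Q, det_fin_three]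

lemma exists_frame_of_pos {u : Fin 3 → ℂ} (hu : herm u u = 1) :
    ∃ P : Matrix (Fin 3) (Fin 3) ℂ, InU21 P ∧ P *ᵥ Pi.single 0 1 = u := by
  have hre := congrArg Complex.re hu
  rw [herm_self_re, Complex.one_re] at hre
  have hpos : 0 < Complex.normSq (u 0) + Complex.normSq (u 1) := by
    linarith [Complex.normSq_nonneg (u 2)]
  rw [herm_apply] at hu
  obtain ⟨ρ, hρ0, hρ⟩ : ∃ ρ : ℝ, (ρ : ℂ) ≠ 0 ∧
      (ρ : ℂ) ^ 2 = star (u 0) * u 0 + star (u 1) * u 1 := by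
    refine ⟨√(Complex.normSq (u 0) + Complex.normSq (u 1)), ?_, ?_⟩
    · exact_mod_cast (Real.sqrt_pos.mpr hpos).ne'
    · rw [← Complex.ofReal_pow, Real.sq_sqrt hpos.le]
      simp [Complex.normSq_eq_conj_mul_self]
  have hρ' : star (u 0) * u 0 = (ρ : ℂ) ^ 2 - star (u 1) * u 1 := by linear_combination -hρ
  have hu' : star (u 2) * u 2 = (ρ : ℂ) ^ 2 - 1 := by linear_combination -hu - hρ
  simp only [Complex.star_def] at hρ' hu' hu
  let p : Fin 3 → Fin 3 → ℂ := ![u, ![-star (u 1) / ρ, star (u 0) / ρ, 0],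
    ![u 0 * star (u 2) / ρ, u 1 * star (u 2) / ρ, ρ]]
  refine ⟨(of p)ᵀ, ?_, by rw [mulVec_single_one]; rfl⟩
  unfold InU21
  rw [gram_cols]
  ext i j
  fin_cases i <;> fin_cases j <;> simp [p, herm_apply, Jball]
  · exact hu
  · ring
  · field_simp
    linear_combination (starRingEnd ℂ) (u 2) * hρ'
  · ring
  · field_simp
    linear_combination hρ'
  · field_simp
    ring
  · field_simp
    linear_combination u 2 * hρ'
  · field_simp
    ring
  · field_simp
    linear_combination (starRingEnd ℂ) (u 2) * u 2 * hρ' + (ρ : ℂ) ^ 2 * hu'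

lemma InU21.isCommU21_of_pos {A : Matrix (Fin 3) (Fin 3) ℂ} (hA : InU21 A) (hdet : A.det = 1)
    {u : Fin 3 → ℂ} (hu : 0 < (herm u u).re)
    (h0 : (A.trace - 2) * herm u u - herm u (A *ᵥ u) ≠ 0)
    (h1 : ‖(A.trace - 2) * herm u u - herm u (A *ᵥ u)‖ < ‖herm u (A *ᵥ u) - herm u u‖) :
    IsCommU21 A := by
  obtain ⟨s, hs⟩ := exists_smul_herm_eq_one hu
  obtain ⟨P, hP, hPu⟩ := exists_frame_of_pos hs
  refine IsCommU21.conj hP ?_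
  have hentry : (P⁻¹ * A * P) 0 0 = star s * s * herm u (A *ᵥ u) := by
    have h : (P⁻¹ * A * P) 0 0 = herm (P *ᵥ Pi.single 0 1) (A *ᵥ P *ᵥ Pi.single 0 1) := by
      rw [mulVec_mulVec, herm_mulVec_mulVec, hP.inv_eq]
      simp [Matrix.mul_assoc, Jball, diagonal_mul]
    rw [h, hPu, mulVec_smul, herm_smul_left, herm_smul_right, mul_assoc]
  have htr : (P⁻¹ * A * P).trace = A.trace := by
    rw [trace_mul_comm, mul_nonsing_inv_cancel_left _ _ hP.isUnit_det]
  rw [herm_smul_left, herm_smul_right] at hs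
  have hss : star s * s ≠ 0 := by
    intro h
    rw [← mul_assoc, h, zero_mul] at hs
    exact zero_ne_one hs
  have e1 : A.trace - star s * s * herm u (A *ᵥ u) - 2 =
      star s * s * ((A.trace - 2) * herm u u - herm u (A *ᵥ u)) := by
    linear_combination (2 - A.trace) * hs
  have e2 : star s * s * herm u (A *ᵥ u) - 1 =
      star s * s * (herm u (A *ᵥ u) - herm u u) := by
    linear_combination hs
  refine ((hP.inv.mul hA).mul hP).isCommU21_of_entry ?_ ?_ ?_
  · rw [det_mul, det_mul, hdet, mul_one, ← det_mul, nonsing_inv_mul _ hP.isUnit_det, det_one]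
  · rw [hentry, htr, e1]
    exact mul_ne_zero hss h0
  · rw [hentry, htr, e1, e2, norm_mul, norm_mul (star s * s)]
    exact mul_lt_mul_of_pos_left h1 (norm_pos_iff.mpr hss)

open Filter Topology in
lemma InU21.isCommU21_of_null {A : Matrix (Fin 3) (Fin 3) ℂ} (hA : InU21 A) (hdet : A.det = 1)
    {v : Fin 3 → ℂ} (hv : herm v v = 0)
    (h : 0 < (herm v (A *ᵥ v) * star A.trace).re - 3 * (herm v (A *ᵥ v)).re) :
    IsCommU21 A := by
  have hg : herm v (A *ᵥ v) ≠ 0 := by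
    intro hg
    simp [hg] at h
  set u : ℝ → Fin 3 → ℂ := fun ε => v + (ε : ℂ) • (Jball *ᵥ v) with hu
  set t := A.trace
  have hcont1 : Continuous fun ε => herm (u ε) (u ε) := by
    simp only [hu, herm_apply, Pi.add_apply, Pi.smul_apply]
    fun_prop
  have hcont2 : Continuous fun ε => herm (u ε) (A *ᵥ u ε) := by
    simp only [hu, herm_apply, Pi.add_apply, Pi.smul_apply, mulVec, dotProduct,
      Fin.sum_univ_three]
    fun_prop
  have hu0 : u 0 = v := by simp [hu]
  have hk : ∀ ε, (herm (u ε) (u ε)).re =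
      2 * ε * (Complex.normSq (v 0) + Complex.normSq (v 1) + Complex.normSq (v 2)) := by
    intro ε
    have h2 := congrArg Complex.re hv
    simp [herm_self_re, Complex.normSq_apply] at h2
    simp [herm_self_re, hu, Jball, Complex.normSq_apply, mulVec_diagonal]
    linear_combination (1 + ε ^ 2) * h2
  have hn : 0 < Complex.normSq (v 0) + Complex.normSq (v 1) + Complex.normSq (v 2) := by
    by_contra! hcon
    have n0 := Complex.normSq_nonneg (v 0)
    have n1 := Complex.normSq_nonneg (v 1)
    have n2 := Complex.normSq_nonneg (v 2)
    have e0 := Complex.normSq_eq_zero.mp (by linarith : Complex.normSq (v 0) = 0)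
    have e1 := Complex.normSq_eq_zero.mp (by linarith : Complex.normSq (v 1) = 0)
    have e2 := Complex.normSq_eq_zero.mp (by linarith : Complex.normSq (v 2) = 0)
    apply hg
    simp [herm_apply, e0, e1, e2]
  have ev1 : ∀ᶠ ε in 𝓝 (0 : ℝ),
      (t - 2) * herm (u ε) (u ε) - herm (u ε) (A *ᵥ u ε) ≠ 0 := by
    have hc : Continuous fun ε => (t - 2) * herm (u ε) (u ε) - herm (u ε) (A *ᵥ u ε) := by
      fun_prop
    refine hc.continuousAt.eventually_ne ?_
    simp [hu0, hv, hg]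
  have ev2 : ∀ᶠ ε in 𝓝 (0 : ℝ), 0 < 2 * (herm (u ε) (A *ᵥ u ε) * star t).re -
      6 * (herm (u ε) (A *ᵥ u ε)).re + (herm (u ε) (u ε)).re * (1 - Complex.normSq (t - 2)) := by
    have hc : Continuous fun ε => 2 * (herm (u ε) (A *ᵥ u ε) * star t).re -
      6 * (herm (u ε) (A *ᵥ u ε)).re + (herm (u ε) (u ε)).re * (1 - Complex.normSq (t - 2)) := by
      fun_prop
    refine hc.continuousAt.eventually (lt_mem_nhds ?_)
    simp only [hu0, hv, Complex.zero_re]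
    linarith
  obtain ⟨ε, ⟨h1, h2⟩, hε⟩ :=
    (((ev1.and ev2).filter_mono nhdsWithin_le_nhds).and
      (self_mem_nhdsWithin : Set.Ioi (0 : ℝ) ∈ 𝓝[>] 0)).exists
  have hεk : 0 < (herm (u ε) (u ε)).re := by
    rw [hk]
    have : (0 : ℝ) < ε := hε
    positivity
  refine hA.isCommU21_of_pos hdet hεk h1 ?_
  rw [herm_self_eq_re (u ε)]
  generalize (herm (u ε) (u ε)).re = k at *
  generalize herm (u ε) (A *ᵥ u ε) = g at *
  have h3 := mul_pos hεk h2
  rw [← sq_lt_sq₀ (norm_nonneg _) (norm_nonneg _), ← Complex.normSq_eq_norm_sq,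
    ← Complex.normSq_eq_norm_sq]
  simp [Complex.normSq_apply] at h3 ⊢
  linarith

lemma exists_cube_root_one_re_le (g : ℂ) : ∃ ω : ℂ, ω ^ 3 = 1 ∧ (ω * g).re ≤ -‖g‖ / 2 := by
  have h3 : (√3 : ℝ) ^ 2 = 3 := Real.sq_sqrt (by norm_num)
  have hG : ‖g‖ ^ 2 = g.re ^ 2 + g.im ^ 2 := by
    rw [← Complex.normSq_eq_norm_sq, Complex.normSq_apply]
    ring
  have hG0 := norm_nonneg g
  by_cases hx : g.re ≤ -‖g‖ / 2
  · exact ⟨1, by norm_num, by simpa using hx⟩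
  push Not at hx
  have hroot : ∀ σ : ℝ, σ ^ 2 = 3 → (⟨-1 / 2, σ / 2⟩ : ℂ) ^ 3 = 1 := by
    intro σ hσ
    apply Complex.ext <;> simp [pow_succ]
    · linear_combination (3 / 8) * hσ
    · linear_combination (-σ / 8) * hσ
  have hkey : ‖g‖ - g.re ≤ √3 * |g.im| := by
    refine abs_le_of_sq_le_sq' ?_ (by positivity) |>.2
    rw [mul_pow, h3, sq_abs]
    nlinarith [Complex.re_le_norm g]
  rcases le_total 0 g.im with him | him
  · refine ⟨⟨-1 / 2, √3 / 2⟩, hroot _ h3, ?_⟩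
    rw [abs_of_nonneg him] at hkey
    simp
    linarith
  · refine ⟨⟨-1 / 2, -√3 / 2⟩, hroot _ (by rw [neg_sq, h3]), ?_⟩
    rw [abs_of_nonpos him] at hkey
    simp
    linarith

lemma InU21.exists_comm_of_null {A : Matrix (Fin 3) (Fin 3) ℂ} (hA : InU21 A)
    {v : Fin 3 → ℂ} (hv : herm v v = 0)
    (h : 0 < (herm v (A *ᵥ v) * star A.trace).re + 3 / 2 * ‖herm v (A *ᵥ v)‖) :
    ∃ c : ℂ, star c * c = 1 ∧ IsCommU21 (c • A) := by
  obtain ⟨ζ, hζ⟩ := IsAlgClosed.exists_pow_nat_eq (star A.det) (n := 3) (by norm_num)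
  obtain ⟨ω, hω, hg⟩ := exists_cube_root_one_re_le (ζ * herm v (A *ᵥ v))
  have hdet : (ω * ζ) ^ 3 * A.det = 1 := by
    rw [mul_pow, hω, hζ, one_mul, hA.star_det_mul_det]
  have hnω : ‖ω‖ = 1 := by
    have h3 : ‖ω‖ ^ 3 = 1 := by rw [← norm_pow, hω, norm_one]
    exact (pow_eq_one_iff_of_nonneg (norm_nonneg _) (by norm_num)).mp h3
  have hnd := norm_eq_one_of_star_mul_self hA.star_det_mul_det
  have hnζ : ‖ζ‖ = 1 := by
    have h3 : ‖ζ‖ ^ 3 = 1 := by rw [← norm_pow, hζ, norm_star, hnd]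
    exact (pow_eq_one_iff_of_nonneg (norm_nonneg _) (by norm_num)).mp h3
  have hc : star (ω * ζ) * (ω * ζ) = 1 := by
    rw [Complex.star_def, Complex.conj_mul', norm_mul, hnω, hnζ]
    simp
  refine ⟨ω * ζ, hc, (hA.smul hc).isCommU21_of_null ?_ hv ?_⟩
  · rw [det_smul, Fintype.card_fin, hdet]
  · rw [smul_mulVec, herm_smul_right, trace_smul, smul_eq_mul, star_mul']
    have e : ω * ζ * herm v (A *ᵥ v) * (star (ω * ζ) * star A.trace) =
        herm v (A *ᵥ v) * star A.trace := by
      linear_combination herm v (A *ᵥ v) * star A.trace * hc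
    rw [← star_mul', star_mul', e, mul_assoc]
    rw [norm_mul, hnζ, one_mul] at hg
    linarith

/-- The first-order condition at a null vector under which `A` has, up to a scalar, a
suitable positive vector nearby. -/
def HasGoodNull (A : Matrix (Fin 3) (Fin 3) ℂ) : Prop :=
  ∃ v : Fin 3 → ℂ, herm v v = 0 ∧
    0 < (herm v (A *ᵥ v) * star A.trace).re + 3 / 2 * ‖herm v (A *ᵥ v)‖

lemma hasGoodNull_of_frame {A P H : Matrix (Fin 3) (Fin 3) ℂ} (hP : Pᴴ * Jball * P = H)
    (hu : IsUnit P.det) {x : Fin 3 → ℂ} (hx : star x ⬝ᵥ (H *ᵥ x) = 0)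
    (h : 0 < ((star x ⬝ᵥ (H *ᵥ ((P⁻¹ * A * P) *ᵥ x))) * star (P⁻¹ * A * P).trace).re +
      3 / 2 * ‖star x ⬝ᵥ (H *ᵥ ((P⁻¹ * A * P) *ᵥ x))‖) : HasGoodNull A := by
  have htr : (P⁻¹ * A * P).trace = A.trace := by
    rw [trace_mul_comm, mul_nonsing_inv_cancel_left _ _ hu]
  have he : herm (P *ᵥ x) (A *ᵥ P *ᵥ x) = star x ⬝ᵥ (H *ᵥ ((P⁻¹ * A * P) *ᵥ x)) := by
    rw [← hP, mulVec_mulVec, herm_mulVec_mulVec, mulVec_mulVec]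
    congr 2
    simp only [Matrix.mul_assoc, mul_nonsing_inv_cancel_left _ _ hu]
  refine ⟨P *ᵥ x, ?_, ?_⟩
  · rw [herm_mulVec_mulVec, hP, hx]
  · rw [he, ← htr]
    exact h

lemma not_scalar_conj {A P : Matrix (Fin 3) (Fin 3) ℂ} (hu : IsUnit P.det)
    (hns : ∀ c : ℂ, A ≠ c • (1 : Matrix (Fin 3) (Fin 3) ℂ)) (c : ℂ) :
    P⁻¹ * A * P ≠ c • (1 : Matrix (Fin 3) (Fin 3) ℂ) := by
  intro h
  apply hns c
  calc A = P * (P⁻¹ * A * P) * P⁻¹ := by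
        simp only [Matrix.mul_assoc, mul_nonsing_inv_cancel_left _ _ hu, mul_nonsing_inv _ hu,
          Matrix.mul_one]
    _ = c • (1 : Matrix (Fin 3) (Fin 3) ℂ) := by
        rw [h, Matrix.mul_smul, Matrix.smul_mul, Matrix.mul_one, mul_nonsing_inv _ hu]

/-- The shape of a matrix in `U(1,1)`. -/
lemma exists_unitary_one_one_form {b c d e : ℂ} (h1 : star b * b - star d * d = 1)
    (h2 : star b * c - star d * e = 0) (h3 : star c * c - star e * e = -1) :
    ∃ η α β : ℂ, star η * η = 1 ∧ b = η * α ∧ d = η * β ∧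
      c = η * star β ∧ e = η * star α := by
  obtain ⟨η, hη⟩ := IsAlgClosed.exists_pow_nat_eq (b * e - c * d) (n := 2) (by norm_num)
  have he : e = η ^ 2 * star b := by
    rw [hη]
    linear_combination (-e) * h1 + d * h2
  have hc : c = η ^ 2 * star d := by
    rw [hη]
    linear_combination (-c) * h1 + b * h2
  have hηη : star η * η = 1 := by
    have h4 : (star η * η) ^ 2 = 1 := by
      rw [he, hc] at h3
      simp only [star_mul', star_pow, star_star] at h3
      linear_combination (star η * η) ^ 2 * (-h1) - h3
    have h5 : ‖η‖ ^ 4 = 1 := by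
      have := congrArg norm h4
      rw [norm_pow, norm_mul, norm_star, norm_one] at this
      linear_combination this
    have h6 : ‖η‖ = 1 := (pow_eq_one_iff_of_nonneg (norm_nonneg _) (by norm_num)).mp h5
    rw [Complex.star_def, Complex.conj_mul', h6]
    simp
  refine ⟨η, star η * b, star η * d, hηη, ?_, ?_, ?_, ?_⟩
  · linear_combination (-b) * hηη
  · linear_combination (-d) * hηη
  · simp only [star_mul', star_star]
    linear_combination hc
  · simp only [star_mul', star_star]
    linear_combination he

lemma re_sub_mul_star_add_pos {x y : ℂ} (hx : star x * x = 1) (hy : star y * y = 1)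
    (hne : x ≠ y) : 0 < ((x - y) * star (x + 2 * y)).re + 3 / 2 * ‖x - y‖ := by
  have hxn := norm_eq_one_of_star_mul_self hx
  have hyn := norm_eq_one_of_star_mul_self hy
  have hpos : 0 < ‖x - y‖ := norm_pos_iff.mpr (sub_ne_zero.mpr hne)
  have h2 : ‖x - y‖ ≤ 2 := (norm_sub_le _ _).trans (by rw [hxn, hyn]; norm_num)
  have hsq : ‖x - y‖ ^ 2 = (x.re - y.re) ^ 2 + (x.im - y.im) ^ 2 := by
    rw [← Complex.normSq_eq_norm_sq, Complex.normSq_apply]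
    simp
    ring
  have hx' := congrArg Complex.re hx
  have hy' := congrArg Complex.re hy
  simp at hx' hy'
  have : ((x - y) * star (x + 2 * y)).re = -‖x - y‖ ^ 2 / 2 := by
    rw [hsq]
    simp
    linear_combination (3 / 2) * hx' - (3 / 2) * hy'
  rw [this]
  nlinarith

lemma InU21.hasGoodNull_of_block {A : Matrix (Fin 3) (Fin 3) ℂ} (hA : InU21 A)
    (hns : ∀ c : ℂ, A ≠ c • (1 : Matrix (Fin 3) (Fin 3) ℂ))
    (h10 : A 1 0 = 0) (h20 : A 2 0 = 0) : HasGoodNull A := by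
  have hent : ∀ i j, (Aᴴ * Jball * A) i j = Jball i j := fun i j => by rw [hA]
  simp [mul_apply, Fin.sum_univ_three, Jball, diagonal_apply] at hent
  have e00 := hent 0 0
  have e01 := hent 0 1
  have e02 := hent 0 2
  have e11 := hent 1 1
  have e12 := hent 1 2
  have e22 := hent 2 2
  simp [h10, h20] at e00 e01 e02 e11 e12 e22
  have hne : A 0 0 ≠ 0 := by
    intro h
    simp [h] at e00
  have h01 : A 0 1 = 0 := e01.resolve_left hne
  have h02 : A 0 2 = 0 := e02.resolve_left hne
  simp [h01, h02] at e11 e12 e22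
  obtain ⟨η, α, β, hη, hb, hd, hc, he⟩ :=
    exists_unitary_one_one_form (b := A 1 1) (c := A 1 2) (d := A 2 1) (e := A 2 2)
      (by rw [Complex.star_def]; linear_combination e11)
      (by rw [Complex.star_def]; linear_combination e12)
      (by rw [Complex.star_def]; linear_combination e22)
  set μ := A 0 0 with hμ
  have hμ1 : star μ * μ = 1 := e00
  have htr : A.trace = μ + η * (2 * α.re : ℝ) := by
    rw [trace_fin_three, hb, he]
    have := Complex.add_conj α
    rw [Complex.star_def]
    linear_combination η * this
  by_cases hκ : ∃ y : ℂ, star y * y = 1 ∧ α.im - (β * y).im ≠ 0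
  · obtain ⟨y, hy, hκ⟩ := hκ
    set κ := α.im - (β * y).im with hκd
    have hg : herm ![0, y, 1] (A *ᵥ ![0, y, 1]) = η * (2 * κ : ℝ) * Complex.I := by
      have e1 := Complex.sub_conj α
      push_cast at e1
      have e2 := Complex.sub_conj (β * y)
      rw [map_mul] at e2
      rw [Complex.star_def] at hy
      simp [herm_apply, mulVec, dotProduct, Fin.sum_univ_three, h01, h02, hb, hc, hd, he, hκd]
        at e2 ⊢
      linear_combination η * α * hy + η * e1 - η * e2
    refine ⟨![0, y, 1], ?_, ?_⟩
    · simp [herm_apply]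
      rw [Complex.star_def] at hy
      linear_combination hy
    · rw [hg, htr]
      have hn : ‖η * (2 * κ : ℝ) * Complex.I‖ = 2 * |κ| := by
        simp [norm_eq_one_of_star_mul_self hη]
      have hre : (η * (2 * κ : ℝ) * Complex.I * star (μ + η * (2 * α.re : ℝ))).re =
          (η * (2 * κ : ℝ) * Complex.I * star μ).re := by
        have : η * (2 * κ : ℝ) * Complex.I * star (μ + η * (2 * α.re : ℝ)) =
            η * (2 * κ : ℝ) * Complex.I * star μ + ((2 * κ * (2 * α.re) : ℝ) : ℂ) * Complex.I := by
          rw [Complex.star_def, map_add, map_mul, Complex.conj_ofReal]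
          rw [Complex.star_def] at hη
          push_cast
          linear_combination 2 * κ * (2 * α.re) * Complex.I * hη
        rw [this]
        simp
      have hle := neg_le_of_abs_le (Complex.abs_re_le_norm (η * (2 * κ : ℝ) * Complex.I * star μ))
      rw [norm_mul, hn, norm_star, norm_eq_one_of_star_mul_self hμ1] at hle
      rw [hn, hre]
      have := abs_pos.mpr hκ
      linarith
  · push Not at hκ
    have k1 := hκ 1 (by simp)
    have k2 := hκ (-1) (by simp)
    have k3 := hκ Complex.I (by simp)
    simp at k1 k2 k3
    have hα : α.im = 0 := by linarith
    have hβ : β = 0 := Complex.ext (by simp; linarith) (by simp; linarith)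
    have hαc : star α = α := Complex.conj_eq_iff_im.mpr hα
    have hbe : A 2 2 = A 1 1 := by rw [hb, he, hαc]
    have hc0 : A 1 2 = 0 := by rw [hc, hβ]; simp
    have hd0 : A 2 1 = 0 := by rw [hd, hβ]; simp
    rw [hd0] at e11
    have hbb : star (A 1 1) * A 1 1 = 1 := by simpa using e11
    have hne' : μ ≠ A 1 1 := by
      intro h
      apply hns μ
      ext i j
      fin_cases i <;> fin_cases j <;>
        simp [h10, h20, h01, h02, hc0, hd0, hbe, ← h, ← hμ]
    refine ⟨![1, 0, 1], by simp [herm_apply], ?_⟩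
    have hg : herm ![1, 0, 1] (A *ᵥ ![1, 0, 1]) = μ - A 1 1 := by
      simp [herm_apply, mulVec, dotProduct, Fin.sum_univ_three, h20, h02, hbe, ← hμ]
    have ht : A.trace = μ + 2 * A 1 1 := by
      rw [trace_fin_three, hbe]
      ring
    rw [hg, ht]
    exact re_sub_mul_star_add_pos hμ1 hbb hne'

lemma InU21.hasGoodNull_of_pos_eigenvector {A : Matrix (Fin 3) (Fin 3) ℂ} (hA : InU21 A)
    (hns : ∀ c : ℂ, A ≠ c • (1 : Matrix (Fin 3) (Fin 3) ℂ)) {u : Fin 3 → ℂ} {μ : ℂ}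
    (hu : 0 < (herm u u).re) (hAu : A *ᵥ u = μ • u) : HasGoodNull A := by
  obtain ⟨s, hs⟩ := exists_smul_herm_eq_one hu
  obtain ⟨P, hP, hPu⟩ := exists_frame_of_pos hs
  have hcol : (P⁻¹ * A * P) *ᵥ Pi.single 0 1 = μ • Pi.single 0 1 := by
    rw [← mulVec_mulVec, hPu, ← mulVec_mulVec, mulVec_smul, hAu, smul_comm, ← hPu, mulVec_smul,
      mulVec_mulVec, nonsing_inv_mul _ hP.isUnit_det, one_mulVec]
  rw [mulVec_single_one] at hcol
  have h10 := congrFun hcol 1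
  have h20 := congrFun hcol 2
  simp only [col_apply, Pi.smul_apply, Pi.single_apply] at h10 h20
  obtain ⟨v, hv, h⟩ := ((hP.inv.mul hA).mul hP).hasGoodNull_of_block
    (not_scalar_conj hP.isUnit_det hns) (by simpa using h10) (by simpa using h20)
  exact hasGoodNull_of_frame hP hP.isUnit_det hv h

lemma InU21.exists_nonneg_eigenvector {A : Matrix (Fin 3) (Fin 3) ℂ} (hA : InU21 A) :
    ∃ (v : Fin 3 → ℂ) (x : ℂ), v ≠ 0 ∧ A *ᵥ v = x • v ∧ 0 ≤ (herm v v).re := by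
  obtain ⟨x, hx⟩ := Module.End.exists_eigenvalue (toLin' A)
  obtain ⟨e, he⟩ := hx.exists_hasEigenvector
  have hAe : A *ᵥ e = x • e := by simpa using he.apply_eq_smul
  have he0 := he.2
  by_cases hneg : 0 ≤ (herm e e).re
  · exact ⟨e, x, he0, hAe, hneg⟩
  push Not at hneg
  have hx0 : x ≠ 0 := by
    rintro rfl
    have h := hA.herm_mulVec e e
    rw [hAe, zero_smul] at h
    rw [← h] at hneg
    simp [herm_apply] at hneg
  let φ : (Fin 3 → ℂ) →ₗ[ℂ] ℂ :=
    { toFun := herm e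
      map_add' := fun a b => by simp [herm_apply]; ring
      map_smul' := fun c a => herm_smul_right c e a }
  let W := LinearMap.ker φ
  have hmem : ∀ y, y ∈ W ↔ herm e y = 0 := fun y => LinearMap.mem_ker
  have hW : ∀ y ∈ W, toLin' A y ∈ W := by
    intro y hy
    rw [hmem] at hy ⊢
    have h := hA.herm_mulVec e y
    rw [hAe, herm_smul_left, hy] at h
    rw [toLin'_apply]
    exact (mul_eq_zero.mp h).resolve_left (star_ne_zero.mpr hx0)
  have hneg' := hneg
  rw [herm_self_re] at hneg'
  have he2 : e 2 ≠ 0 := by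
    intro h
    rw [h, map_zero] at hneg'
    linarith [Complex.normSq_nonneg (e 0), Complex.normSq_nonneg (e 1)]
  have hnt : Nontrivial W := by
    refine ⟨⟨⟨![star (e 2), 0, star (e 0)], ?_⟩, 0, ?_⟩⟩
    · rw [hmem, herm_apply]
      simp
      ring
    · intro h
      have := congrFun (congrArg Subtype.val h) 0
      simp [he2] at this
  obtain ⟨z, hz⟩ := Module.End.exists_eigenvalue ((toLin' A).restrict hW)
  obtain ⟨f, hf⟩ := hz.exists_hasEigenvector
  have hAf : A *ᵥ (f : Fin 3 → ℂ) = z • (f : Fin 3 → ℂ) := by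
    have := congrArg Subtype.val hf.apply_eq_smul
    simpa using this
  refine ⟨f, z, fun h => hf.2 (Subtype.ext h), hAf, ?_⟩
  have hef := (hmem f).mp f.2
  generalize (f : Fin 3 → ℂ) = f at *
  rw [herm_apply] at hef
  rw [herm_self_re]
  by_contra! hcon
  have h1 : ‖e 2‖ * ‖f 2‖ ≤ ‖e 0‖ * ‖f 0‖ + ‖e 1‖ * ‖f 1‖ := by
    have h : star (e 2) * f 2 = star (e 0) * f 0 + star (e 1) * f 1 := by
      linear_combination -hef
    calc ‖e 2‖ * ‖f 2‖ = ‖star (e 2) * f 2‖ := by rw [norm_mul, norm_star]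
      _ = ‖star (e 0) * f 0 + star (e 1) * f 1‖ := by rw [h]
      _ ≤ _ := (norm_add_le _ _).trans (by rw [norm_mul, norm_mul, norm_star, norm_star])
  simp only [Complex.normSq_eq_norm_sq] at hcon hneg'
  have h2 : (‖e 2‖ * ‖f 2‖) ^ 2 ≤ (‖e 0‖ ^ 2 + ‖e 1‖ ^ 2) * (‖f 0‖ ^ 2 + ‖f 1‖ ^ 2) :=
    (pow_le_pow_left₀ (by positivity) h1 2).trans
      (by nlinarith [sq_nonneg (‖e 0‖ * ‖f 1‖ - ‖e 1‖ * ‖f 0‖)])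
  have h3 : (‖e 0‖ ^ 2 + ‖e 1‖ ^ 2) * (‖f 0‖ ^ 2 + ‖f 1‖ ^ 2) < ‖e 2‖ ^ 2 * ‖f 2‖ ^ 2 :=
    mul_lt_mul'' (by linarith) (by linarith) (by positivity) (by positivity)
  rw [mul_pow] at h2
  linarith

/-- Gram matrix of a basis made of a null vector, a positive unit vector and a null vector. -/
def flagGram : Matrix (Fin 3) (Fin 3) ℂ := !![0, 0, 1; 0, 1, 0; 1, 0, 0]

lemma exists_frame_of_null {v : Fin 3 → ℂ} (hv : herm v v = 0) (hv0 : v ≠ 0) :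
    ∃ (s : ℂ) (P : Matrix (Fin 3) (Fin 3) ℂ), Pᴴ * Jball * P = flagGram ∧ IsUnit P.det ∧
      P *ᵥ Pi.single 0 1 = s • v := by
  have hre := congrArg Complex.re hv
  rw [herm_self_re, Complex.zero_re] at hre
  have h2 : v 2 ≠ 0 := by
    intro h
    rw [h, map_zero] at hre
    have n0 := Complex.normSq_nonneg (v 0)
    have n1 := Complex.normSq_nonneg (v 1)
    have e0 := Complex.normSq_eq_zero.mp (by linarith : Complex.normSq (v 0) = 0)
    have e1 := Complex.normSq_eq_zero.mp (by linarith : Complex.normSq (v 1) = 0)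
    apply hv0
    ext i
    fin_cases i <;> simp [*]
  have hs : herm ((v 2)⁻¹ • v) ((v 2)⁻¹ • v) = 0 := by
    rw [herm_smul_left, herm_smul_right, hv, mul_zero, mul_zero]
  set y := (v 2)⁻¹ • v with hy
  have hy2 : y 2 = 1 := by simp [hy, h2]
  rw [herm_apply, hy2] at hs
  simp only [Complex.star_def, map_one] at hs
  let p : Fin 3 → Fin 3 → ℂ :=
    ![y, ![-star (y 1), star (y 0), 0], ![y 0 / 2, y 1 / 2, -1 / 2]]
  have hgram : ((of p)ᵀ)ᴴ * Jball * (of p)ᵀ = flagGram := by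
    rw [gram_cols]
    ext i j
    fin_cases i <;> fin_cases j <;> simp [p, herm_apply, flagGram, hy2, map_ofNat]
    · linear_combination hs
    · ring
    · linear_combination hs / 2
    · ring
    · linear_combination hs
    · ring
    · linear_combination hs / 2
    · ring
    · linear_combination hs / 4
  exact ⟨(v 2)⁻¹, (of p)ᵀ, hgram,
    isUnit_det_of_gram hgram (by simp [flagGram, det_fin_three]), by rw [mulVec_single_one]; rfl⟩

lemma exists_affine_re_add_norm_pos {d : ℂ} (hd : d ≠ 0) (q t : ℂ) :
    ∃ τ : ℝ, 0 < ((τ * d + q) * star t).re + 3 / 2 * ‖τ * d + q‖ := by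
  have hd' := norm_pos_iff.mpr hd
  have hkey : ∀ τ : ℝ, 0 ≤ τ * (d * star t).re →
      |τ| * ‖d‖ = ‖q‖ + ‖q‖ * ‖t‖ + 1 →
      0 < ((τ * d + q) * star t).re + 3 / 2 * ‖τ * d + q‖ := by
    intro τ h1 h2
    have h3 : ‖q‖ * ‖t‖ + 1 ≤ ‖τ * d + q‖ := by
      have := norm_sub_le (τ * d + q) q
      rw [add_sub_cancel_right, norm_mul, Complex.norm_real, Real.norm_eq_abs, h2] at this
      linarith
    have h4 : ((τ * d + q) * star t).re = τ * (d * star t).re + (q * star t).re := by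
      rw [add_mul, Complex.add_re, mul_assoc, Complex.re_ofReal_mul]
    have h5 := neg_le_of_abs_le (Complex.abs_re_le_norm (q * star t))
    rw [norm_mul, norm_star] at h5
    have h6 : 0 ≤ ‖q‖ * ‖t‖ := by positivity
    linarith
  set T := (‖q‖ + ‖q‖ * ‖t‖ + 1) / ‖d‖ with hT
  have hT0 : 0 ≤ T := by positivity
  have hTd : T * ‖d‖ = ‖q‖ + ‖q‖ * ‖t‖ + 1 := div_mul_cancel₀ _ hd'.ne'
  rcases le_total 0 (d * star t).re with h | h
  · exact ⟨T, hkey T (mul_nonneg hT0 h) (by rw [abs_of_nonneg hT0, hTd])⟩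
  · exact ⟨-T, hkey (-T) (mul_nonneg_of_nonpos_of_nonpos (by linarith) h)
      (by rw [abs_neg, abs_of_nonneg hT0, hTd])⟩

lemma InU21.hasGoodNull_of_null_eigenvector {A : Matrix (Fin 3) (Fin 3) ℂ} (hA : InU21 A)
    (hns : ∀ c : ℂ, A ≠ c • (1 : Matrix (Fin 3) (Fin 3) ℂ)) {v : Fin 3 → ℂ} {l : ℂ}
    (hv0 : v ≠ 0) (hv : herm v v = 0) (hAv : A *ᵥ v = l • v) : HasGoodNull A := by
  by_cases hpos : ∃ (u : Fin 3 → ℂ) (μ : ℂ), 0 < (herm u u).re ∧ A *ᵥ u = μ • u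
  · obtain ⟨u, μ, hu, hAu⟩ := hpos
    exact hA.hasGoodNull_of_pos_eigenvector hns hu hAu
  push Not at hpos
  obtain ⟨s, P, hP, hPu, hPv⟩ := exists_frame_of_null hv hv0
  set M := P⁻¹ * A * P with hM
  have hPM : P * M = A * P := by
    simp only [hM, Matrix.mul_assoc, mul_nonsing_inv_cancel_left _ _ hPu]
  have hcol : M *ᵥ Pi.single 0 1 = l • Pi.single 0 1 := by
    rw [hM, ← mulVec_mulVec, hPv, ← mulVec_mulVec, mulVec_smul, hAv, smul_comm, ← hPv,
      mulVec_smul, mulVec_mulVec, nonsing_inv_mul _ hPu, one_mulVec]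
  rw [mulVec_single_one] at hcol
  have h00 := congrFun hcol 0
  have h10 := congrFun hcol 1
  have h20 := congrFun hcol 2
  simp [col_apply] at h00 h10 h20
  have hMM : Mᴴ * flagGram * M = flagGram := by
    calc Mᴴ * flagGram * M = (P * M)ᴴ * Jball * (P * M) := by
          rw [← hP, conjTranspose_mul P M]
          simp only [Matrix.mul_assoc]
      _ = Pᴴ * (Aᴴ * Jball * A) * P := by
          rw [hPM, conjTranspose_mul]
          simp only [Matrix.mul_assoc]
      _ = flagGram := by rw [hA, hP]
  have hent : ∀ i j, (Mᴴ * flagGram * M) i j = flagGram i j := fun i j => by rw [hMM]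
  simp [mul_apply, Fin.sum_univ_three, flagGram] at hent
  have e01 := hent 0 1
  have e02 := hent 0 2
  have e12 := hent 1 2
  have e22 := hent 2 2
  simp [h00, h10, h20] at e01 e02
  have hl : l ≠ 0 := by
    rintro rfl
    simp at e02
  have h21 : M 2 1 = 0 := e01.resolve_left hl
  simp [h21] at e12 e22
  have h11 : M 1 1 = l := by
    by_contra hne
    have hd : M 1 1 - l ≠ 0 := sub_ne_zero.mpr hne
    refine hpos (P *ᵥ ![M 0 1, M 1 1 - l, 0]) (M 1 1) ?_ ?_
    · rw [herm_mulVec_mulVec, hP]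
      have : star ![M 0 1, M 1 1 - l, 0] ⬝ᵥ flagGram *ᵥ ![M 0 1, M 1 1 - l, 0] =
          ((Complex.normSq (M 1 1 - l) : ℝ) : ℂ) := by
        rw [Complex.normSq_eq_conj_mul_self]
        simp [flagGram, dotProduct, mulVec, Fin.sum_univ_three]
      rw [this, Complex.ofReal_re]
      exact Complex.normSq_pos.mpr hd
    · rw [mulVec_mulVec, ← hPM, ← mulVec_mulVec, ← mulVec_smul]
      congr 1
      ext i
      fin_cases i <;> simp [mulVec, dotProduct, Fin.sum_univ_three, h00, h10, h20, h21]
      ring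
  have e11 := hent 1 1
  simp [h21, h11] at e11
  have h22 : M 2 2 = l := by linear_combination l * e02 - M 2 2 * e11
  rw [h22, h11] at e12
  rw [h22] at e22
  have hg : ∀ β : ℂ, star ![-(star β * β) / 2, β, 1] ⬝ᵥ
      (flagGram *ᵥ (M *ᵥ ![-(star β * β) / 2, β, 1])) =
        M 0 1 * β + M 1 2 * star β + M 0 2 := by
    intro β
    simp [flagGram, dotProduct, mulVec, Fin.sum_univ_three, h00, h10, h20, h21, h11, h22, map_ofNat]
    ring
  have hnull : ∀ β : ℂ, star ![-(star β * β) / 2, β, 1] ⬝ᵥ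
      (flagGram *ᵥ ![-(star β * β) / 2, β, 1]) = 0 := by
    intro β
    simp [flagGram, dotProduct, mulVec, Fin.sum_univ_three, map_ofNat]
    ring
  by_cases h01 : M 0 1 = 0
  · have h12 : M 1 2 = 0 := by
      rw [h01] at e12
      simpa [hl] using e12
    rw [h12] at e22
    have h02 : M 0 2 ≠ 0 := by
      intro h02
      apply not_scalar_conj hPu hns l
      rw [← hM]
      ext i j
      fin_cases i <;> fin_cases j <;> simp [h00, h10, h20, h01, h11, h21, h02, h12, h22]
    refine hasGoodNull_of_frame hP hPu (hnull 0) ?_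
    rw [← hM, hg, trace_fin_three, h00, h11, h22]
    have hre : (M 0 2 * star (l + l + l)).re = 0 := by
      have := congrArg Complex.re e22
      simp at this ⊢
      linarith
    simp only [star_zero, mul_zero, zero_add, hre]
    have := norm_pos_iff.mpr h02
    positivity
  · by_cases hd : M 0 1 + M 1 2 = 0
    · have hd' : (M 0 1 - M 1 2) * Complex.I ≠ 0 := by
        refine mul_ne_zero (fun h => h01 ?_) Complex.I_ne_zero
        linear_combination (h + hd) / 2
      obtain ⟨τ, hτ⟩ := exists_affine_re_add_norm_pos hd' (M 0 2) M.trace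
      refine hasGoodNull_of_frame hP hPu (hnull (τ * Complex.I)) ?_
      have : M 0 1 * (τ * Complex.I) + M 1 2 * star (τ * Complex.I) + M 0 2 =
          τ * ((M 0 1 - M 1 2) * Complex.I) + M 0 2 := by
        simp only [Complex.star_def, map_mul, Complex.conj_ofReal, Complex.conj_I]
        ring
      rw [← hM, hg, this]
      exact hτ
    · obtain ⟨τ, hτ⟩ := exists_affine_re_add_norm_pos hd (M 0 2) M.trace
      refine hasGoodNull_of_frame hP hPu (hnull τ) ?_
      have : M 0 1 * τ + M 1 2 * star (τ : ℂ) + M 0 2 = τ * (M 0 1 + M 1 2) + M 0 2 := by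
        rw [Complex.star_def, Complex.conj_ofReal]
        ring
      rw [← hM, hg, this]
      exact hτ

/-- Every holomorphic isometry of H²_ℂ is a commutator of holomorphic isometries:
the commutator length of PU(2,1) is 1. -/
theorem commutator_length_one (A : Matrix (Fin 3) (Fin 3) ℂ) (hA : InU21 A) :
    ∃ (B C : Matrix (Fin 3) (Fin 3) ℂ) (c : ℂ),
      c ≠ 0 ∧ InU21 B ∧ InU21 C ∧
      A = c • (B * C * B⁻¹ * C⁻¹) := by
  by_cases hs : ∃ c : ℂ, A = c • (1 : Matrix (Fin 3) (Fin 3) ℂ)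
  · obtain ⟨c, rfl⟩ := hs
    refine ⟨1, 1, c, ?_, InU21.one, InU21.one, by simp⟩
    rintro rfl
    simpa using hA.isUnit_det
  push Not at hs
  have hgood : HasGoodNull A := by
    obtain ⟨v, x, hv0, hAv, hv⟩ := hA.exists_nonneg_eigenvector
    rcases hv.lt_or_eq with hv | hv
    · exact hA.hasGoodNull_of_pos_eigenvector hs hv hAv
    · refine hA.hasGoodNull_of_null_eigenvector hs hv0 ?_ hAv
      rw [herm_self_eq_re, ← hv, Complex.ofReal_zero]
  obtain ⟨v, hv, h⟩ := hgood
  obtain ⟨c, hc, B, C, hB, hC, hcA⟩ := hA.exists_comm_of_null hv h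
  refine ⟨B, C, star c, ?_, hB, hC, ?_⟩
  · intro h0
    simp [h0] at hc
  · rw [← hcA, smul_smul, hc, one_smul]
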